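/- arXiv:1409.5948 — 2 statements merged into one kernel-verified Lean document; each statement's English description precedes it below -/
import Mathlib

section
/- Let p, c ∈ (0,1) and let φ : (0,∞) → (0,1] satisfy the p-thinning invariance equation φ(λ) = p φ(cλ)/(1 − (1 − p) φ(cλ)) for all λ > 0. Then the function ψ(λ) = 1/φ(λ) − 1 satisfies the functional equation ψ(λ) = (1/p) ψ(cλ) for all λ > 0; that is, ψ(λ) = a ψ(bλ) with a = 1/p > 1 and b = c, so φ is the Laplace transform form of a semi-Mittag-Leffler distribution of exponent α, where α is the unique solution of a b^α = 1 (equivalently c^α = p). -/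
open Set

/-- Forward half of Theorem 3.1: if a Laplace transform `φ` with values in
`(0, 1]` is invariant under `p`-thinning combined with the scale change `c`,
then `ψ(λ) = 1/φ(λ) - 1` satisfies `ψ(λ) = (1/p) ψ(cλ)`, i.e. `φ` is of
semi-Mittag-Leffler form with exponent `α` the unique solution of `c^α = p`. -/
theorem thinning_invariant_semiMittagLeffler
    (p c : ℝ) (hp : p ∈ Set.Ioo (0 : ℝ) 1) (hc : c ∈ Set.Ioo (0 : ℝ) 1)
    (φ : ℝ → ℝ) (hφ_range : ∀ l : ℝ, 0 < l → φ l ∈ Set.Ioc (0 : ℝ) 1)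
    (hinv : ∀ l : ℝ, 0 < l →
      φ l = p * φ (c * l) / (1 - (1 - p) * φ (c * l))) :
    (∀ l : ℝ, 0 < l →
        1 / φ l - 1 = (1 / p) * (1 / φ (c * l) - 1)) ∧
      ∃! α : ℝ, 0 < α ∧ c ^ α = p := by
  obtain ⟨hp0, hp1⟩ := hp
  obtain ⟨hc0, hc1⟩ := hc
  refine ⟨fun l hl => ?_, Real.logb c p, ⟨?_, ?_⟩, ?_⟩
  · obtain ⟨hx0, hx1⟩ := hφ_range (c * l) (mul_pos hc0 hl)
    have hden : 1 - (1 - p) * φ (c * l) ≠ 0 := by nlinarith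
    rw [hinv l hl]
    field_simp
    ring
  · exact Real.logb_pos_of_base_lt_one hc0 hc1 hp0 hp1
  · exact Real.rpow_logb hc0 hc1.ne hp0
  · rintro α ⟨-, hα⟩
    rw [← hα, Real.logb_rpow hc0 hc1.ne]
end

section
/- Let α > 0, let c₁, c₂ ∈ (0,1) with (log c₁)/(log c₂) irrational, and set p₁ = c₁^α, p₂ = c₂^α. Let ψ : (0,∞) → (0,∞) be continuous and satisfy ψ(λ) = (1/p₁) ψ(c₁ λ) and ψ(λ) = (1/p₂) ψ(c₂ λ) for all λ > 0. Then there exists a constant A > 0 such that ψ(λ) = A λ^α for all λ > 0. -/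
open Set Real

/-- A continuous function on `ℝ` with two periods of irrational ratio is constant. -/
theorem Function.Periodic.eq_of_irrational_div {X : Type*} [TopologicalSpace X] [T2Space X]
    {f : ℝ → X} {a b : ℝ} (ha : Function.Periodic f a) (hb : Function.Periodic f b)
    (hf : Continuous f) (hab : Irrational (a / b)) (x y : ℝ) : f x = f y := by
  have hper : ∀ t ∈ AddSubgroup.closure {a, b}, Function.Periodic f t := by
    intro t ht
    induction ht using AddSubgroup.closure_induction with
    | mem t ht =>
      rcases ht with rfl | rfl
      exacts [ha, hb]
    | zero => exact fun z => by rw [add_zero]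
    | add s t _ _ hs ht => exact hs.add_period ht
    | neg t _ ht => exact ht.neg
  have hconst : f = fun _ => f 0 :=
    hf.ext_on (dense_addSubgroupClosure_pair_iff.2 hab) continuous_const
      fun t ht => (hper t ht).eq
  rw [hconst]

/-- In logarithmic coordinates, a function scaling with exponent `α` under multiplication by `c`
becomes, after division by the power law, periodic with period `log c`. -/
theorem periodic_log_of_scaling {α c : ℝ} (hc : 0 < c) {ψ : ℝ → ℝ}
    (h : ∀ l : ℝ, 0 < l → ψ l = (1 / c ^ α) * ψ (c * l)) :
    Function.Periodic (fun x => ψ (Real.exp x) / Real.exp x ^ α) (Real.log c) := by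
  intro x
  have hcα : c ^ α ≠ 0 := (Real.rpow_pos_of_pos hc α).ne'
  have hxα : Real.exp x ^ α ≠ 0 := (Real.rpow_pos_of_pos (Real.exp_pos x) α).ne'
  have hexp : Real.exp (x + Real.log c) = c * Real.exp x := by
    rw [Real.exp_add, Real.exp_log hc, mul_comm]
  simp only [hexp, h _ (Real.exp_pos x), Real.mul_rpow hc.le (Real.exp_pos x).le]
  field_simp

/-- Corollary 3.1: if the thinning-invariance functional equation holds for two
scale factors whose logarithms have irrational ratio, then `ψ(λ) = A λ^α`. -/
theorem two_scales_implies_powerLaw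
    (α : ℝ) (hα : 0 < α)
    (c₁ c₂ : ℝ) (hc₁ : c₁ ∈ Set.Ioo (0 : ℝ) 1) (hc₂ : c₂ ∈ Set.Ioo (0 : ℝ) 1)
    (hirr : Irrational (Real.log c₁ / Real.log c₂))
    (p₁ p₂ : ℝ) (hp₁ : p₁ = c₁ ^ α) (hp₂ : p₂ = c₂ ^ α)
    (ψ : ℝ → ℝ) (hψ_cont : ContinuousOn ψ (Set.Ioi 0))
    (hψ_pos : ∀ l : ℝ, 0 < l → 0 < ψ l)
    (heq₁ : ∀ l : ℝ, 0 < l → ψ l = (1 / p₁) * ψ (c₁ * l))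
    (heq₂ : ∀ l : ℝ, 0 < l → ψ l = (1 / p₂) * ψ (c₂ * l)) :
    ∃ A : ℝ, 0 < A ∧ ∀ l : ℝ, 0 < l → ψ l = A * l ^ α := by
  subst hp₁ hp₂
  have hcont : Continuous fun x => ψ (Real.exp x) / Real.exp x ^ α :=
    (hψ_cont.comp_continuous Real.continuous_exp Real.exp_pos).div
      (Real.continuous_exp.rpow_const fun x => Or.inl (Real.exp_pos x).ne')
      fun x => (Real.rpow_pos_of_pos (Real.exp_pos x) α).ne'
  refine ⟨ψ 1, hψ_pos 1 one_pos, fun l hl => ?_⟩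
  have hl0 := (periodic_log_of_scaling hc₁.1 heq₁).eq_of_irrational_div
    (periodic_log_of_scaling hc₂.1 heq₂) hcont hirr (Real.log l) 0
  simp only [Real.exp_log hl, Real.exp_zero, Real.one_rpow, div_one] at hl0
  exact (div_eq_iff (Real.rpow_pos_of_pos hl α).ne').1 hl0
end
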